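/- Let X and Y be second countable locally compact Hausdorff topological spaces and let f : X → Y be a continuous open surjection. Then there exists a family (λ_y)_{y ∈ Y} of probability measures on X such that: (i) each λ_y is a Radon measure (finite on compact sets and inner regular) whose topological support equals the fiber f⁻¹(y); and (ii) for every continuous compactly supported h : X → ℂ, the map y ↦ ∫ h dλ_y is continuous on Y. -/

import Mathlib

open MeasureTheory
open scoped ENNReal Topology
open Filter Set ProbabilityTheory

/-- For every family of transition probabilities on `ℕ` there is a probability measure on the space
of paths under which the coordinates form a Markov chain started at `0`. -/
theorem exists_markov_chain (q : ℕ → ℕ → PMF ℕ) :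
    ∃ P : Measure (ℕ → ℕ), IsProbabilityMeasure P ∧ (∀ᵐ ω ∂P, ω 0 = 0) ∧
      (∀ n k j, P {ω | ω n = k ∧ ω (n + 1) = j} = q n k j * P {ω | ω n = k}) ∧
      (∀ n (F : ℕ → ℂ) (C : ℝ), (∀ j, ‖F j‖ ≤ C) →
        ∫ ω, F (ω (n + 1)) ∂P = ∫ ω, ∫ j, F j ∂(q n (ω n)).toMeasure ∂P) := by
  let K (n : ℕ) : Kernel ℕ ℕ :=
    ⟨fun k => (q n k).toMeasure, measurable_of_countable _⟩
  have hK (n : ℕ) : IsMarkovKernel (K n) := ⟨fun k => by dsimp [K]; infer_instance⟩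
  let κ (n : ℕ) : Kernel ((i : Finset.Iic n) → ℕ) ℕ :=
    (K n).comap (fun x => x ⟨n, Finset.mem_Iic.2 le_rfl⟩) (by fun_prop)
  have hκ (n : ℕ) : IsMarkovKernel (κ n) := by dsimp [κ]; infer_instance
  let P : Measure (ℕ → ℕ) := Kernel.trajMeasure (X := fun _ => ℕ) (Measure.dirac 0) κ
  have hP : IsProbabilityMeasure P := by dsimp [P]; infer_instance
  have hlaw (n : ℕ) : P.map (Preorder.frestrictLe (π := fun _ => ℕ) n) ⊗ₘ κ n =
      P.map (fun x => (Preorder.frestrictLe (π := fun _ => ℕ) n x, x (n + 1))) :=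
    Kernel.map_frestrictLe_trajMeasure_compProd_eq_map_trajMeasure
  refine ⟨P, hP, ?_, ?_, ?_⟩
  · have : P.map (fun ω => ω 0) = Measure.dirac 0 := by
      have h1 : (fun ω : ℕ → ℕ => ω 0) =
          (fun x : (i : Finset.Iic 0) → ℕ => x ⟨0, by simp⟩) ∘
            Preorder.frestrictLe (π := fun _ => ℕ) 0 := rfl
      rw [h1, ← Measure.map_map (by fun_prop) (by fun_prop)]
      dsimp only [P, Kernel.trajMeasure]
      rw [Measure.map_comp _ _ (by fun_prop), Kernel.traj_map_frestrictLe]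
      simp
    refine ae_of_ae_map (f := fun ω : ℕ → ℕ => ω 0) (p := fun k => k = 0)
      (measurable_pi_apply 0).aemeasurable ?_
    rw [this, ae_dirac_eq]
    simp
  · intro n k j
    have hm : MeasurableSet {p : ((i : Finset.Iic n) → ℕ) × ℕ |
        p.1 ⟨n, Finset.mem_Iic.2 le_rfl⟩ = k ∧ p.2 = j} :=
      (measurableSet_eq_fun (by fun_prop) (by fun_prop)).inter
        (measurableSet_eq_fun (by fun_prop) (by fun_prop))
    have := congrArg (fun μ => μ {p | p.1 ⟨n, Finset.mem_Iic.2 le_rfl⟩ = k ∧ p.2 = j}) (hlaw n)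
    beta_reduce at this
    rw [Measure.map_apply (by fun_prop) hm, Measure.compProd_apply hm,
      lintegral_map (Kernel.measurable_kernel_prodMk_left hm) (by fun_prop)] at this
    refine Eq.trans this.symm ?_
    rw [← lintegral_indicator_const
      (measurableSet_eq_fun (by fun_prop) (by fun_prop) : MeasurableSet {ω : ℕ → ℕ | ω n = k})]
    refine lintegral_congr fun ω => ?_
    by_cases h : ω n = k
    · simp [κ, K, h, ← PMF.toMeasure_apply_singleton (q n k) j (measurableSet_singleton j)]
    · simp [h]
  · intro n F C hC
    have hi : Integrable (fun p : ((i : Finset.Iic n) → ℕ) × ℕ => F p.2)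
        (P.map (Preorder.frestrictLe (π := fun _ => ℕ) n) ⊗ₘ κ n) := by
      rw [hlaw]
      have : IsProbabilityMeasure (P.map (fun x =>
          (Preorder.frestrictLe (π := fun _ => ℕ) n x, x (n + 1)))) :=
        Measure.isProbabilityMeasure_map (by fun_prop)
      exact Integrable.of_bound ((measurable_of_countable F).comp
        measurable_snd).aestronglyMeasurable C (ae_of_all _ fun p => hC _)
    have := Measure.integral_compProd hi
    rwa [hlaw, integral_map (by fun_prop) (hlaw n ▸ hi).aestronglyMeasurable,
      integral_map (by fun_prop)] at this
    refine Measurable.aestronglyMeasurable ?_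
    exact (measurable_of_countable (fun k => ∫ j, F j ∂(K n k))).comp
      (measurable_pi_apply (⟨n, Finset.mem_Iic.2 le_rfl⟩ : Finset.Iic n))

/-- If the open sets `O j`, `j ∈ A`, cover `V`, there are probability weights on `ℕ`, depending on
`y ∈ V`, that charge exactly the `j ∈ A` with `y ∈ O j` and against which bounded families `G j`,
each continuous on `O j`, integrate to a function continuous on `V`. -/
theorem exists_pmf_continuousOn {Y : Type*} [TopologicalSpace Y]
    [TopologicalSpace.MetrizableSpace Y] (O : ℕ → Set Y) (hO : ∀ j, IsOpen (O j))
    (A : Set ℕ) (V : Set Y) (hV : ∀ y ∈ V, ∃ j ∈ A, y ∈ O j) :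
    ∃ q : Y → PMF ℕ, (∀ y ∈ V, ∀ j, q y j ≠ 0 ↔ j ∈ A ∧ y ∈ O j) ∧
      ∀ (G : ℕ → Y → ℂ) (C : ℝ), (∀ j y, ‖G j y‖ ≤ C) → (∀ j, ContinuousOn (G j) (O j)) →
        ContinuousOn (fun y => ∫ j, G j y ∂(q y).toMeasure) V := by
  classical
  have hg (j : ℕ) : ∃ g : Y → ℝ, Continuous g ∧ (∀ y, 0 ≤ g y) ∧ (∀ y, g y ≤ 1) ∧
      ∀ y, g y ≠ 0 ↔ y ∈ O j := by
    let _ := TopologicalSpace.metrizableSpaceMetric Y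
    by_cases hne : (O j)ᶜ.Nonempty
    · refine ⟨fun y => min 1 (Metric.infDist y (O j)ᶜ), by fun_prop,
        fun y => le_min zero_le_one Metric.infDist_nonneg, fun y => min_le_left _ _, fun y => ?_⟩
      have h := (hO j).isClosed_compl.notMem_iff_infDist_pos hne (x := y)
      rw [notMem_compl_iff] at h
      rw [h]
      constructor
      · intro h0
        refine lt_of_le_of_ne Metric.infDist_nonneg fun h1 => h0 ?_
        simp [← h1]
      · intro h0
        positivity
    · refine ⟨fun _ => 1, continuous_const, by simp, by simp, fun y => ?_⟩
      simp [show O j = univ by simpa [not_nonempty_iff_eq_empty] using hne]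
  choose g hgc hg0 hg1 hgO using hg
  let w (j : ℕ) (y : Y) : ℝ := if j ∈ A then (1 / 2) ^ j * g j y else 0
  have hw0 (j y) : 0 ≤ w j y := by
    have := hg0 j y
    dsimp only [w]; split_ifs <;> positivity
  have hw1 (j y) : w j y ≤ (1 / 2) ^ j := by
    dsimp only [w]; split_ifs
    · exact mul_le_of_le_one_right (by positivity) (hg1 j y)
    · positivity
  have hwne (j y) : w j y ≠ 0 ↔ j ∈ A ∧ y ∈ O j := by
    dsimp only [w]; split_ifs with h <;> simp [h, ← hgO]
  have hwc (j) : Continuous (w j) := by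
    have := hgc j
    dsimp only [w]; split_ifs <;> fun_prop
  have hsum : Summable fun j : ℕ => (1 / 2 : ℝ) ^ j := summable_geometric_two
  have hws (y) : Summable fun j => w j y := hsum.of_nonneg_of_le (hw0 · y) (hw1 · y)
  have hZc : Continuous fun y => ∑' j, w j y :=
    continuous_tsum hwc hsum fun j y => by rw [Real.norm_of_nonneg (hw0 j y)]; exact hw1 j y
  have hZ (y) (hy : y ∈ V) : 0 < ∑' j, w j y := by
    obtain ⟨j, hj⟩ := hV y hy
    exact (hws y).tsum_pos (hw0 · y) j (lt_of_le_of_ne (hw0 j y) ((hwne j y).2 hj).symm)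
  have htop (y) : ∑' j, ENNReal.ofReal (w j y) ≠ ∞ := by
    rw [← ENNReal.ofReal_tsum_of_nonneg (hw0 · y) (hws y)]; exact ENNReal.ofReal_ne_top
  have hnz (y) (hy : y ∈ V) : ∑' j, ENNReal.ofReal (w j y) ≠ 0 := by
    rw [← ENNReal.ofReal_tsum_of_nonneg (hw0 · y) (hws y)]
    simpa using hZ y hy
  let q (y : Y) : PMF ℕ := if hy : y ∈ V then PMF.normalize _ (hnz y hy) (htop y) else PMF.pure 0
  have hq (y) (hy : y ∈ V) (j) : (q y j).toReal = (∑' j, w j y)⁻¹ * w j y := by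
    simp only [q, hy, dite_true, PMF.normalize_apply]
    rw [← ENNReal.ofReal_tsum_of_nonneg (hw0 · y) (hws y), ENNReal.toReal_mul, ENNReal.toReal_inv,
      ENNReal.toReal_ofReal (hw0 j y), ENNReal.toReal_ofReal (hZ y hy).le, mul_comm]
  refine ⟨q, fun y hy j => ?_, fun G C hC hG => ?_⟩
  · have := hq y hy j
    rw [← hwne]
    constructor
    · intro h h0
      rw [h0, mul_zero, ENNReal.toReal_eq_zero_iff] at this
      exact this.elim h ((q y).apply_ne_top j)
    · intro h h0
      rw [h0] at this
      simp [h, (hZ y hy).ne'] at this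
  · have heq : EqOn (fun y => ∫ j, G j y ∂(q y).toMeasure)
        (fun y => (∑' j, w j y)⁻¹ • ∑' j, w j y • G j y) V := by
      intro y hy
      have hi : Integrable (fun j => G j y) (q y).toMeasure :=
        Integrable.of_bound (measurable_of_countable _).aestronglyMeasurable C
          (ae_of_all _ fun j => hC j y)
      beta_reduce
      rw [PMF.integral_eq_tsum _ _ hi, ← tsum_const_smul'']
      exact tsum_congr fun j => by rw [hq y hy, mul_smul]
    refine ContinuousOn.congr ?_ heq
    refine (hZc.continuousOn.inv₀ fun y hy => (hZ y hy).ne').smul (Continuous.continuousOn ?_)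
    refine continuous_tsum (u := fun j => (1 / 2) ^ j * C) (fun j => ?_) (hsum.mul_right C) ?_
    · rw [continuous_iff_continuousAt]
      intro y
      by_cases hy : y ∈ O j
      · exact (hwc j).continuousAt.smul ((hG j).continuousAt ((hO j).mem_nhds hy))
      · have h0 : w j y = 0 := by
          by_contra h
          exact hy ((hwne j y).1 h).2
        rw [ContinuousAt, h0, zero_smul]
        have ht : Tendsto (w j) (𝓝 y) (𝓝 0) := h0 ▸ (hwc j).continuousAt
        exact ht.zero_smul_isBoundedUnder_le (isBoundedUnder_of ⟨C, fun z => hC j z⟩)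
    · intro j y
      rw [norm_smul, Real.norm_of_nonneg (hw0 j y)]
      exact mul_le_mul (hw1 j y) (hC j y) (norm_nonneg _) (by positivity)

/-- Given open sets `O k` and relations `r n` such that every `y ∈ O k` lies in some `O j` with
`r n k j`, there are path measures `P y`, depending continuously on `y`, that live on the paths
`ω` with `r n (ω n) (ω (n + 1))` and `y ∈ O (ω n)` for all `n`, and charge every such finite step. -/
theorem exists_path_measures {Y : Type*} [TopologicalSpace Y]
    [TopologicalSpace.MetrizableSpace Y] (O : ℕ → Set Y) (hO : ∀ j, IsOpen (O j))
    (hO0 : O 0 = univ) (r : ℕ → ℕ → ℕ → Prop)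
    (hr : ∀ n k, ∀ y ∈ O k, ∃ j, r n k j ∧ y ∈ O j) :
    ∃ P : Y → Measure (ℕ → ℕ), (∀ y, IsProbabilityMeasure (P y)) ∧
      (∀ y, ∀ᵐ ω ∂P y, ω 0 = 0 ∧ ∀ n, y ∈ O (ω n) ∧ r n (ω n) (ω (n + 1))) ∧
      (∀ y n k j, P y {ω | ω n = k} ≠ 0 → y ∈ O k → r n k j → y ∈ O j →
        P y {ω | ω (n + 1) = j} ≠ 0) ∧
      ∀ n (F : ℕ → ℂ) (C : ℝ), (∀ j, ‖F j‖ ≤ C) →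
        Continuous fun y => ∫ ω, F (ω n) ∂P y := by
  choose q hq hqc using fun n k =>
    exists_pmf_continuousOn O hO {j | r n k j} (O k) (fun y hy => hr n k y hy)
  choose P hP hP0 hPj hPi using fun y => exists_markov_chain (fun n k => q n k y)
  refine ⟨P, hP, fun y => ?_, fun y n k j hk hyk hj hyj => ?_, fun n F C hF => ?_⟩
  · have h : ∀ᵐ ω ∂P y, ∀ n, q n (ω n) y (ω (n + 1)) ≠ 0 := by
      refine ae_all_iff.2 fun n => ?_
      have h0 : ∀ k j, ∀ᵐ ω ∂P y, q n k y j = 0 → ¬ (ω n = k ∧ ω (n + 1) = j) := by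
        intro k j
        by_cases h : q n k y j = 0
        · have := hPj y n k j
          rw [h, zero_mul] at this
          simpa [h] using measure_eq_zero_iff_ae_notMem.1 this
        · simp [h]
      filter_upwards [ae_all_iff.2 fun k => ae_all_iff.2 (h0 k)] with ω hω h
      exact hω _ _ h ⟨rfl, rfl⟩
    filter_upwards [h, hP0 y] with ω hω h0
    have hmem (n : ℕ) : y ∈ O (ω n) := by
      induction n with
      | zero => simp [h0, hO0]
      | succ n ih => exact ((hq n _ y ih _).1 (hω n)).2
    exact ⟨h0, fun n => ⟨hmem n, ((hq n _ y (hmem n) _).1 (hω n)).1⟩⟩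
  · have h : P y {ω | ω n = k ∧ ω (n + 1) = j} ≠ 0 := by
      rw [hPj]
      exact mul_ne_zero ((hq n k y hyk j).2 ⟨hj, hyj⟩) hk
    exact fun h0 => h (measure_mono_null (fun ω hω => hω.2) h0)
  · have key : ∀ n (G : ℕ → Y → ℂ), (∀ j y, ‖G j y‖ ≤ C) → (∀ j, ContinuousOn (G j) (O j)) →
        Continuous fun y => ∫ ω, G (ω n) y ∂P y := by
      intro n
      induction n with
      | zero =>
        intro G hG hGc
        have h (y) : ∫ ω, G (ω 0) y ∂P y = G 0 y := by
          rw [integral_congr_ae (g := fun _ => G 0 y)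
            ((hP0 y).mono fun ω hω => by simp [hω])]
          simp
        simp_rw [h]
        have := hGc 0
        rwa [hO0, continuousOn_univ] at this
      | succ n ih =>
        intro G hG hGc
        simp_rw [fun y => hPi y n (fun j => G j y) C (hG · y)]
        refine ih (fun k y => ∫ j, G j y ∂(q n k y).toMeasure) (fun k y => ?_)
          fun k => hqc n k G C hG hGc
        simpa using norm_integral_le_of_norm_le_const (μ := (q n k y).toMeasure)
          (ae_of_all _ (hG · y))
    exact key n (fun j _ => F j) (fun j _ => hF j) fun j => continuousOn_const

/-- Points chosen in a nested sequence of relatively compact sets of vanishing diameter, all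
meeting the fiber over `y`, converge to a point of that fiber. -/
theorem exists_tendsto_of_nested {X Y : Type*} [MetricSpace X] [TopologicalSpace Y] [T2Space Y]
    {f : X → Y} (hf : Continuous f) {y : Y} {S : ℕ → Set X} {u : ℕ → X}
    (hy : ∀ n, y ∈ f '' S n) (hu : ∀ n, u n ∈ S n)
    (hc : IsCompact (closure (S 1))) (hS : Antitone S)
    (hd : ∀ n, ∀ a ∈ S (n + 1), ∀ b ∈ S (n + 1), dist a b ≤ (1 / 2) ^ n) :
    ∃ c, Tendsto u atTop (𝓝 c) ∧ f c = y ∧ (∀ n, c ∈ closure (S n)) ∧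
      ∀ n, dist (u (n + 1)) c ≤ (1 / 2) ^ n := by
  have hpow : Tendsto (fun n : ℕ => (1 / 2 : ℝ) ^ n) atTop (𝓝 0) :=
    tendsto_pow_atTop_nhds_zero_of_lt_one (by norm_num) (by norm_num)
  have hcau : CauchySeq fun n => u (n + 1) :=
    cauchySeq_of_le_tendsto_0 _ (fun n m N hn hm => hd N _ (hS (by lia) (hu (n + 1))) _
      (hS (by lia) (hu (m + 1)))) hpow
  obtain ⟨c, -, hlim⟩ := cauchySeq_tendsto_of_isComplete hc.isComplete
    (fun n => subset_closure (hS (by lia) (hu (n + 1)))) hcau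
  have hlim' : Tendsto u atTop (𝓝 c) := (tendsto_add_atTop_iff_nat 1).1 hlim
  have hcl (n : ℕ) : c ∈ closure (S n) :=
    mem_closure_of_tendsto hlim' ((eventually_ge_atTop n).mono fun m hm => hS hm (hu m))
  have hdist (n : ℕ) : dist (u (n + 1)) c ≤ (1 / 2) ^ n :=
    le_of_tendsto (tendsto_const_nhds.dist hlim') ((eventually_ge_atTop (n + 1)).mono
      fun m hm => hd n _ (hu _) _ (hS hm (hu m)))
  refine ⟨c, hlim', ?_, hcl, hdist⟩
  choose z hzS hzy using hy
  have hz : Tendsto (fun n => z (n + 1)) atTop (𝓝 c) := by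
    refine tendsto_iff_dist_tendsto_zero.2 (squeeze_zero (fun _ => dist_nonneg)
      (g := fun n => (1 / 2) ^ n + (1 / 2) ^ n)
      (fun n => (dist_triangle _ (u (n + 1)) c).trans ?_) ?_)
    · exact add_le_add (hd n _ (hzS _) _ (hu _)) (hdist n)
    · simpa using hpow.add hpow
  have h := (hf.tendsto c).comp hz
  simp only [Function.comp_def, hzy] at h
  exact tendsto_nhds_unique h tendsto_const_nhds

/-- A countable base of relatively compact open sets of small diameter, with the whole space
added as its first member. -/
theorem exists_seq_isOpen_refining (X : Type*) [MetricSpace X] [LocallyCompactSpace X]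
    [SecondCountableTopology X] :
    ∃ B : ℕ → Set X, B 0 = univ ∧ (∀ k, IsOpen (B k)) ∧
      ∀ V : Set X, IsOpen V → ∀ x ∈ V, ∀ ε > 0, ∃ j, x ∈ B j ∧ B j ⊆ V ∧
        IsCompact (closure (B j)) ∧ ∀ a ∈ B j, ∀ b ∈ B j, dist a b ≤ ε := by
  obtain ⟨b, hbc, -, hb⟩ := TopologicalSpace.exists_countable_basis X
  obtain ⟨e, he⟩ := (hbc.union (countable_singleton ∅)).exists_eq_range (by simp)
  refine ⟨fun n => n.casesOn univ e, rfl, fun k => ?_, fun V hV x hx ε hε => ?_⟩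
  · cases k with
    | zero => exact isOpen_univ
    | succ n =>
      have : e n ∈ b ∪ {∅} := he ▸ mem_range_self n
      rcases this with h | h
      · exact hb.isOpen h
      · simp [show e n = ∅ from h]
  · obtain ⟨K, hK, hxK⟩ := exists_compact_mem_nhds x
    obtain ⟨s, hsb, hxs, hs⟩ := hb.mem_nhds_iff.1
      (inter_mem (inter_mem (hV.mem_nhds hx) hxK) (Metric.closedBall_mem_nhds x (half_pos hε)))
    obtain ⟨n, rfl⟩ : s ∈ range e := he ▸ Or.inl hsb
    refine ⟨n + 1, hxs, fun a ha => (hs ha).1.1,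
      hK.closure_of_subset fun a ha => (hs ha).1.2, fun a ha b hb => ?_⟩
    have h1 : dist a x ≤ ε / 2 := (hs ha).2
    have h2 : dist b x ≤ ε / 2 := (hs hb).2
    linarith [dist_triangle_right a b x]

/-- Blanchard's theorem: a continuous open surjection `f : X → Y` between second
countable locally compact Hausdorff spaces admits a full continuous `f`-system of
probability Radon measures, i.e. measures `λ_y` supported exactly on the fibers
`f⁻¹(y)` with `y ↦ ∫ h dλ_y` continuous for every `h ∈ C_c(X)`. -/
theorem exists_continuous_fiber_system
    {X Y : Type*}
    [TopologicalSpace X] [T2Space X] [LocallyCompactSpace X] [SecondCountableTopology X]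
    [TopologicalSpace Y] [T2Space Y] [LocallyCompactSpace Y] [SecondCountableTopology Y]
    [MeasurableSpace X] [BorelSpace X]
    (f : X → Y) (hf : Continuous f) (hfo : IsOpenMap f) (hfs : Function.Surjective f) :
    ∃ lam : Y → Measure X,
      (∀ y, IsProbabilityMeasure (lam y)) ∧
      (∀ y, IsFiniteMeasureOnCompacts (lam y)) ∧
      (∀ y, (lam y).InnerRegular) ∧
      (∀ y, {x | ∀ U : Set X, IsOpen U → x ∈ U → 0 < lam y U} = f ⁻¹' {y}) ∧
      (∀ h : X → ℂ, Continuous h → HasCompactSupport h →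
        Continuous fun y => ∫ x, h x ∂(lam y)) := by
  have : TopologicalSpace.MetrizableSpace Y :=
    TopologicalSpace.metrizableSpace_of_t3_secondCountable Y
  have : TopologicalSpace.MetrizableSpace X :=
    TopologicalSpace.metrizableSpace_of_t3_secondCountable X
  let _ := TopologicalSpace.metrizableSpaceMetric X
  rcases isEmpty_or_nonempty X with hX | hX
  · have : IsEmpty Y := ⟨fun y => hX.elim (hfs y).choose⟩
    exact ⟨fun y => 0, isEmptyElim, isEmptyElim, isEmptyElim, isEmptyElim,
      fun h _ _ => continuous_of_discreteTopology⟩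
  obtain ⟨B, hB0, hBo, hB⟩ := exists_seq_isOpen_refining X
  let r (n k j : ℕ) : Prop := B j ⊆ B k ∧ IsCompact (closure (B j)) ∧
    ∀ a ∈ B j, ∀ b ∈ B j, dist a b ≤ (1 / 2) ^ n
  have hrB (n k x) (hx : x ∈ B k) : ∃ j, r n k j ∧ x ∈ B j := by
    obtain ⟨j, h1, h2⟩ := hB (B k) (hBo k) x hx ((1 / 2) ^ n) (by positivity)
    exact ⟨j, h2, h1⟩
  obtain ⟨P, hP, hPae, hPpos, hPc⟩ := exists_path_measures (fun k => f '' B k)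
    (fun k => hfo _ (hBo k)) (by simp [hB0, hfs.range_eq]) r (by
      rintro n k y ⟨x, hx, rfl⟩
      obtain ⟨j, h1, h2⟩ := hrB n k x hx
      exact ⟨j, h1, x, h2, rfl⟩)
  have hpt (k : ℕ) : ∃ x, (B k).Nonempty → x ∈ B k := by
    by_cases h : (B k).Nonempty
    · exact ⟨h.some, fun _ => h.some_mem⟩
    · exact ⟨Classical.arbitrary X, fun h' => absurd h' h⟩
  choose pt hpt using hpt
  have hL (ω : ℕ → ℕ) : ∃ c, (∃ c', Tendsto (fun n => pt (ω n)) atTop (𝓝 c')) →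
      Tendsto (fun n => pt (ω n)) atTop (𝓝 c) := by
    by_cases h : ∃ c', Tendsto (fun n => pt (ω n)) atTop (𝓝 c')
    · exact ⟨h.choose, fun _ => h.choose_spec⟩
    · exact ⟨Classical.arbitrary X, fun h' => absurd h' h⟩
  choose L hL using hL
  have hLae (y : Y) : ∀ᵐ ω ∂P y, Tendsto (fun n => pt (ω n)) atTop (𝓝 (L ω)) ∧ f (L ω) = y ∧
      (∀ n, L ω ∈ closure (B (ω n))) ∧ ∀ n, dist (pt (ω (n + 1))) (L ω) ≤ (1 / 2) ^ n := by
    filter_upwards [hPae y] with ω ⟨h0, hω⟩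
    obtain ⟨c, hc, h⟩ := exists_tendsto_of_nested hf (S := fun n => B (ω n))
      (u := fun n => pt (ω n)) (fun n => (hω n).1) (fun n => hpt _ (image_nonempty.1 ⟨y, (hω n).1⟩))
      (hω 0).2.2.1 (antitone_nat_of_succ_le fun n => (hω n).2.1) fun n => (hω n).2.2.2
    rw [tendsto_nhds_unique (hL ω ⟨c, hc⟩) hc]
    exact ⟨hc, h⟩
  have hLm (y : Y) : AEMeasurable L (P y) :=
    aemeasurable_of_tendsto_metrizable_ae atTop
      (fun n => ((measurable_of_countable pt).comp (measurable_pi_apply n)).aemeasurable)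
      ((hLae y).mono fun ω hω => hω.1)
  have hprob (y : Y) : IsProbabilityMeasure ((P y).map L) :=
    Measure.isProbabilityMeasure_map (hLm y)
  refine ⟨fun y => (P y).map L, hprob, fun y => inferInstance, fun y => inferInstance,
    fun y => Subset.antisymm (fun x hx => ?_) ?_, fun h hh hhc => ?_⟩
  · by_contra hxy
    refine (hx (f ⁻¹' {y})ᶜ (isClosed_singleton.preimage hf).isOpen_compl hxy).ne' ?_
    rw [Measure.map_apply_of_aemeasurable (hLm y)
      (isClosed_singleton.preimage hf).isOpen_compl.measurableSet]
    exact measure_eq_zero_iff_ae_notMem.2 ((hLae y).mono fun ω hω => by simp [hω.2.1])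
  · rintro x rfl U hU hxU
    have hreach (n : ℕ) : ∃ k, x ∈ B k ∧ P (f x) {ω | ω n = k} ≠ 0 := by
      induction n with
      | zero =>
        refine ⟨0, by simp [hB0], fun h => ?_⟩
        obtain ⟨ω, h1, h2⟩ :=
          ((hPae (f x)).and (measure_eq_zero_iff_ae_notMem.1 h)).exists
        exact h2 h1.1
      | succ n ih =>
        obtain ⟨k, hxk, hk⟩ := ih
        obtain ⟨j, hj, hxj⟩ := hrB n k x hxk
        exact ⟨j, hxj, hPpos _ n k j hk ⟨x, hxk, rfl⟩ hj ⟨x, hxj, rfl⟩⟩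
    obtain ⟨ε, hε, hεU⟩ := Metric.isOpen_iff.1 hU x hxU
    obtain ⟨n, hn⟩ := exists_pow_lt_of_lt_one hε (by norm_num : (1 / 2 : ℝ) < 1)
    obtain ⟨k, hxk, hk⟩ := hreach (n + 1)
    rw [Measure.map_apply_of_aemeasurable (hLm _) hU.measurableSet]
    refine (pos_iff_ne_zero.2 hk).trans_le (measure_mono_ae ?_)
    filter_upwards [hLae (f x), hPae (f x)] with ω hω hω' (hωk : ω (n + 1) = k)
    refine hεU (lt_of_le_of_lt ?_ hn)
    have hsub : closure (B k) ⊆ Metric.closedBall x ((1 / 2) ^ n) :=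
      closure_minimal (fun a ha => (hωk ▸ (hω'.2 n).2.2.2) a ha x hxk) Metric.isClosed_closedBall
    exact hsub (hωk ▸ hω.2.2.1 (n + 1))
  · obtain ⟨C, hC⟩ := hh.bounded_above_of_compact_support hhc
    have hLint (y : Y) : ∫ x, h x ∂(P y).map L = ∫ ω, h (L ω) ∂P y :=
      integral_map (hLm y) hh.aestronglyMeasurable
    simp_rw [hLint]
    have huc := hhc.uniformContinuous_of_continuous hh
    have hunif : TendstoUniformly (fun n y => ∫ ω, h (pt (ω (n + 1))) ∂P y)
        (fun y => ∫ ω, h (L ω) ∂P y) atTop := by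
      rw [Metric.tendstoUniformly_iff]
      intro ε hε
      obtain ⟨δ, hδ, hδh⟩ := Metric.uniformContinuous_iff.1 huc (ε / 2) (half_pos hε)
      have hpow : Tendsto (fun n : ℕ => (1 / 2 : ℝ) ^ n) atTop (𝓝 0) :=
        tendsto_pow_atTop_nhds_zero_of_lt_one (by norm_num) (by norm_num)
      filter_upwards [hpow.eventually_lt_const hδ] with n hn y
      have hi1 : Integrable (fun ω => h (L ω)) (P y) :=
        Integrable.of_bound (hh.measurable.comp_aemeasurable (hLm y)).aestronglyMeasurable C
          (ae_of_all _ fun ω => hC _)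
      have hi2 : Integrable (fun ω => h (pt (ω (n + 1)))) (P y) :=
        Integrable.of_bound ((measurable_of_countable fun k => h (pt k)).comp
          (measurable_pi_apply (n + 1))).aestronglyMeasurable C (ae_of_all _ fun ω => hC _)
      rw [dist_eq_norm, ← integral_sub hi1 hi2]
      refine lt_of_le_of_lt (norm_integral_le_of_norm_le_const (C := ε / 2) ?_) (by simp [hε])
      filter_upwards [hLae y] with ω hω
      rw [← dist_eq_norm, dist_comm]
      exact (hδh ((hω.2.2.2 n).trans_lt hn)).le
    exact hunif.continuous (Frequently.of_forall fun n =>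
      hPc (n + 1) (fun k => h (pt k)) C fun k => hC _)
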